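/- For all m, k ≥ 0 and pairwise distinct general atoms P, Q, T, R₁,…,R_m, S₁,…,S_k, the formula (P → (R₁∧…∧R_m → Q)) ∧ (S₁∧…∧S_k∧Q → T) → (S₁∧…∧S_k∧R₁∧…∧R_m∧P → T) is provable in CL2. -/

import Mathlib

/-- CL2-formulas: logical atoms ⊤/⊥, elementary atoms, general atoms,
negation, n-ary ∧, ∨, ⊓, ⊔ (arities other than ≥2 never arise in derivations
of proper formulas). -/
inductive CL2 : Type where
  | top : CL2
  | bot : CL2
  | elem : Nat → CL2
  | gen : Nat → CL2
  | neg : CL2 → CL2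
  | land : List CL2 → CL2
  | lor : List CL2 → CL2
  | chand : List CL2 → CL2
  | chor : List CL2 → CL2

namespace CL2

/-- Elementarization (with a polarity parameter): surface ⊓ becomes ⊤, surface ⊔
becomes ⊥, positive surface general atoms become ⊥, negative ones ⊤. -/
def elz (pos : Bool) : CL2 → CL2
  | top => top
  | bot => bot
  | elem n => elem n
  | gen _ => if pos then bot else top
  | neg F => neg (elz (!pos) F)
  | land l => land (l.attach.map (fun x => elz pos x.1))
  | lor l => lor (l.attach.map (fun x => elz pos x.1))
  | chand _ => top
  | chor _ => bot
termination_by F => sizeOf F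
decreasing_by
  all_goals simp_wf
  all_goals first
    | omega
    | (have h := List.sizeOf_lt_of_mem x.2; omega)

/-- Classical evaluation (used on elementarizations, which contain no
general atoms and no ⊓/⊔). -/
def eval (v : Nat → Bool) : CL2 → Bool
  | top => true
  | bot => false
  | elem n => v n
  | gen _ => false
  | neg F => !(eval v F)
  | land l => (l.attach.map (fun x => eval v x.1)).all id
  | lor l => (l.attach.map (fun x => eval v x.1)).any id
  | chand _ => true
  | chor _ => false
termination_by F => sizeOf F
decreasing_by
  all_goals simp_wf
  all_goals first
    | omega
    | (have h := List.sizeOf_lt_of_mem x.2; omega)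

/-- F is stable iff its elementarization is a classical tautology. -/
def Stable (F : CL2) : Prop := ∀ v : Nat → Bool, eval v (elz true F) = true

/-- Whether the elementary atom `p` occurs (anywhere) in a formula. -/
def elemOccurs (p : Nat) : CL2 → Bool
  | top => false
  | bot => false
  | elem n => n == p
  | gen _ => false
  | neg F => elemOccurs p F
  | land l => (l.attach.map (fun x => elemOccurs p x.1)).any id
  | lor l => (l.attach.map (fun x => elemOccurs p x.1)).any id
  | chand l => (l.attach.map (fun x => elemOccurs p x.1)).any id
  | chor l => (l.attach.map (fun x => elemOccurs p x.1)).any id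
termination_by F => sizeOf F
decreasing_by
  all_goals simp_wf
  all_goals first
    | omega
    | (have h := List.sizeOf_lt_of_mem x.2; omega)

end CL2

/-- One-hole surface contexts: the hole is not in the scope of ⊓ or ⊔. -/
inductive SCtx : Type where
  | hole : SCtx
  | neg : SCtx → SCtx
  | land : List CL2 → SCtx → List CL2 → SCtx
  | lor : List CL2 → SCtx → List CL2 → SCtx

namespace SCtx

def fill : SCtx → CL2 → CL2
  | hole, F => F
  | neg C, F => CL2.neg (fill C F)
  | land l C r, F => CL2.land (l ++ fill C F :: r)
  | lor l C r, F => CL2.lor (l ++ fill C F :: r)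

/-- Number of negations the hole is in the scope of. -/
def negCount : SCtx → Nat
  | hole => 0
  | neg C => negCount C + 1
  | land _ C _ => negCount C
  | lor _ C _ => negCount C

end SCtx

/-- Two-hole surface contexts (the two holes are distinct surface occurrences,
so their least common ancestor is an ∧- or ∨-node). -/
inductive DCtx : Type where
  | neg : DCtx → DCtx
  | land : List CL2 → DCtx → List CL2 → DCtx
  | lor : List CL2 → DCtx → List CL2 → DCtx
  | landS : List CL2 → SCtx → List CL2 → SCtx → List CL2 → DCtx
  | lorS : List CL2 → SCtx → List CL2 → SCtx → List CL2 → DCtx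

namespace DCtx

def fill2 : DCtx → CL2 → CL2 → CL2
  | neg D, A, B => CL2.neg (fill2 D A B)
  | land l D r, A, B => CL2.land (l ++ fill2 D A B :: r)
  | lor l D r, A, B => CL2.lor (l ++ fill2 D A B :: r)
  | landS l C1 m C2 r, A, B => CL2.land (l ++ C1.fill A :: m ++ C2.fill B :: r)
  | lorS l C1 m C2 r, A, B => CL2.lor (l ++ C1.fill A :: m ++ C2.fill B :: r)

def negCount1 : DCtx → Nat
  | neg D => negCount1 D + 1
  | land _ D _ => negCount1 D
  | lor _ D _ => negCount1 D
  | landS _ C1 _ _ _ => C1.negCount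
  | lorS _ C1 _ _ _ => C1.negCount

def negCount2 : DCtx → Nat
  | neg D => negCount2 D + 1
  | land _ D _ => negCount2 D
  | lor _ D _ => negCount2 D
  | landS _ _ _ C2 _ => C2.negCount
  | lorS _ _ _ C2 _ => C2.negCount

end DCtx

/-- The premises of Rule (a) with conclusion `F`: results of replacing a positive
surface occurrence of a ⊓-subformula, or a negative surface occurrence of a
⊔-subformula, by one of its components. -/
def PremiseA (F H : CL2) : Prop :=
  ∃ (C : SCtx) (Gs : List CL2) (i : Fin Gs.length),
    (Even C.negCount ∧ F = C.fill (CL2.chand Gs) ∧ H = C.fill (Gs.get i)) ∨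
    (Odd C.negCount ∧ F = C.fill (CL2.chor Gs) ∧ H = C.fill (Gs.get i))

/-- The premise of Rule (b): `H` results from replacing in `F` a negative surface
occurrence of a ⊓-subformula, or a positive surface occurrence of a ⊔-subformula,
by one of its components. -/
def PremiseB (F H : CL2) : Prop :=
  ∃ (C : SCtx) (Gs : List CL2) (i : Fin Gs.length),
    (Odd C.negCount ∧ F = C.fill (CL2.chand Gs) ∧ H = C.fill (Gs.get i)) ∨
    (Even C.negCount ∧ F = C.fill (CL2.chor Gs) ∧ H = C.fill (Gs.get i))

/-- The premise of Rule (c): `H` results from replacing in `F` two — one positive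
and one negative — surface occurrences of a general atom by an elementary atom
not occurring in `F`. -/
def PremiseC (F H : CL2) : Prop :=
  ∃ (D : DCtx) (P p : Nat),
    F = D.fill2 (CL2.gen P) (CL2.gen P) ∧
    H = D.fill2 (CL2.elem p) (CL2.elem p) ∧
    ((Even D.negCount1 ∧ Odd D.negCount2) ∨ (Odd D.negCount1 ∧ Even D.negCount2)) ∧
    CL2.elemOccurs p F = false

/-- CL2-provability. -/
inductive Provable : CL2 → Prop where
  | ruleA (F : CL2) : CL2.Stable F → (∀ H, PremiseA F H → Provable H) → Provable F
  | ruleB (F H : CL2) : PremiseB F H → Provable H → Provable F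
  | ruleC (F H : CL2) : PremiseC F H → Provable H → Provable F

/-- Implication: F → G abbreviates ¬F ∨ G. -/
def CL2.imp (F G : CL2) : CL2 := CL2.lor [CL2.neg F, G]

/-- `conjImp [F₁,…,Fₙ] T` is F₁∧…∧Fₙ → T, with the conventions that for n = 1 it
is F₁ → T and for n = 0 it is T. -/
def conjImp (l : List CL2) (t : CL2) : CL2 :=
  match l with
  | [] => t
  | [f] => CL2.imp f t
  | l => CL2.imp (CL2.land l) t

/-- `conj1 [F₁,…,Fₙ]` is F₁∧…∧Fₙ, with the convention that for n = 1 it is F₁. -/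
def conj1 (l : List CL2) : CL2 :=
  match l with
  | [f] => f
  | l => CL2.land l

namespace CL2

theorem elz_land (b : Bool) (l : List CL2) : elz b (land l) = land (l.map (elz b)) := by
  rw [elz, List.attach_map_val (f := elz b)]

theorem elz_lor (b : Bool) (l : List CL2) : elz b (lor l) = lor (l.map (elz b)) := by
  rw [elz, List.attach_map_val (f := elz b)]

theorem eval_land (v : Nat → Bool) (l : List CL2) : eval v (land l) = l.all (eval v) := by
  rw [eval, List.attach_map_val (f := eval v), List.all_map]; rfl

theorem eval_lor (v : Nat → Bool) (l : List CL2) : eval v (lor l) = l.any (eval v) := by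
  rw [eval, List.attach_map_val (f := eval v), List.any_map]; rfl

theorem elz_imp (b : Bool) (F G : CL2) : elz b (imp F G) = imp (elz (!b) F) (elz b G) := by
  simp [imp, elz_lor, elz]

theorem eval_imp (v : Nat → Bool) (F G : CL2) :
    eval v (imp F G) = (!eval v F || eval v G) := by
  simp [imp, eval_lor, eval]

theorem elz_conjImp (b : Bool) (l : List CL2) (t : CL2) :
    elz b (conjImp l t) = conjImp (l.map (elz (!b))) (elz b t) := by
  rcases l with _ | ⟨x, _ | ⟨y, l⟩⟩ <;> simp [conjImp, elz_imp, elz_land]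

theorem eval_conjImp (v : Nat → Bool) (l : List CL2) (t : CL2) :
    eval v (conjImp l t) = (!l.all (eval v) || eval v t) := by
  rcases l with _ | ⟨x, _ | ⟨y, l⟩⟩ <;> simp [conjImp, eval_imp, eval_land]

theorem exists_forall_elemOccurs_eq_false (F : CL2) :
    ∃ N, ∀ p, N ≤ p → elemOccurs p F = false := by
  have exists_bound : ∀ l : List CL2,
      (∀ F ∈ l, ∃ N, ∀ p, N ≤ p → elemOccurs p F = false) →
      ∃ N, ∀ p, N ≤ p → ∀ F ∈ l, elemOccurs p F = false := by
    intro l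
    induction l with
    | nil => simp
    | cons G l ih =>
      intro h
      obtain ⟨M, hM⟩ := h G (by simp)
      obtain ⟨N, hN⟩ := ih fun F hF => h F (by simp [hF])
      refine ⟨max M N, fun p hp F hF => ?_⟩
      rcases List.mem_cons.1 hF with rfl | hF
      · exact hM p (by omega)
      · exact hN p (by omega) F hF
  match F with
  | top | bot | gen _ => exact ⟨0, by simp [elemOccurs]⟩
  | elem n => exact ⟨n + 1, fun p hp => by simp [elemOccurs]; omega⟩
  | neg F =>
    obtain ⟨N, hN⟩ := exists_forall_elemOccurs_eq_false F
    exact ⟨N, fun p hp => by rw [elemOccurs]; exact hN p hp⟩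
  | land l | lor l | chand l | chor l =>
    obtain ⟨N, hN⟩ := exists_bound l fun F hF => exists_forall_elemOccurs_eq_false F
    exact ⟨N, fun p hp => by simpa [elemOccurs] using hN p hp⟩
termination_by sizeOf F
decreasing_by
  all_goals simp_wf
  all_goals (have h := List.sizeOf_lt_of_mem hF; omega)

end CL2

open CL2

theorem SCtx.elz_fill_ne {G : CL2} (hG : ∀ b, elz b G ≠ G) (C : SCtx) (b : Bool) :
    elz b (C.fill G) ≠ C.fill G := by
  induction C generalizing b with
  | hole => exact hG b
  | neg C ih => simpa [SCtx.fill, elz] using ih (!b)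
  | land l C r ih =>
    intro h
    simp only [SCtx.fill, elz_land, List.map_append, List.map_cons, CL2.land.injEq] at h
    exact ih b (List.cons.inj (List.append_inj h (by simp)).2).1
  | lor l C r ih =>
    intro h
    simp only [SCtx.fill, elz_lor, List.map_append, List.map_cons, CL2.lor.injEq] at h
    exact ih b (List.cons.inj (List.append_inj h (by simp)).2).1

/-- Classical tautologies without general atoms or choice operators are provable. -/
theorem Provable.of_elz_eq_self {F : CL2} (h : elz true F = F) (hF : ∀ v, eval v F = true) :
    Provable F := by
  refine .ruleA F (fun v => by rw [h, hF]) ?_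
  rintro H ⟨C, Gs, i, ⟨-, rfl, -⟩ | ⟨-, rfl, -⟩⟩
  · exact absurd h (C.elz_fill_ne (by simp [elz]) true)
  · exact absurd h (C.elz_fill_ne (by simp [elz]) true)

/-- Rule (c), with the fresh atom replaced by a universally quantified one. -/
theorem Provable.of_forall_elem (D : DCtx) (P : Nat)
    (hD : (Even D.negCount1 ∧ Odd D.negCount2) ∨ (Odd D.negCount1 ∧ Even D.negCount2))
    (h : ∀ a, Provable (D.fill2 (elem a) (elem a))) :
    Provable (D.fill2 (gen P) (gen P)) := by
  obtain ⟨N, hN⟩ := exists_forall_elemOccurs_eq_false (D.fill2 (gen P) (gen P))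
  exact .ruleC _ _ ⟨D, P, N, rfl, rfl, hD, hN N le_rfl⟩ (h N)

theorem exists_sctx_conjImp_antecedent (l r : List CL2) (t : CL2) :
    ∃ C : SCtx, C.negCount = 1 ∧ ∀ x, C.fill x = conjImp (l ++ x :: r) t := by
  by_cases h : l = [] ∧ r = []
  · obtain ⟨rfl, rfl⟩ := h
    exact ⟨.lor [] (.neg .hole) [t], rfl, fun x => rfl⟩
  · refine ⟨.lor [] (.neg (.land l .hole r)) [t], rfl, fun x => ?_⟩
    rcases l with _ | ⟨y, _ | ⟨z, l⟩⟩ <;> rcases r with _ | ⟨w, r⟩ <;>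
      simp_all [SCtx.fill, conjImp, CL2.imp]

theorem exists_sctx_conjImp_consequent (l : List CL2) :
    ∃ C : SCtx, C.negCount = 0 ∧ ∀ x, C.fill x = conjImp l x := by
  rcases l with _ | ⟨y, _ | ⟨z, l⟩⟩
  · exact ⟨.hole, rfl, fun x => rfl⟩
  · exact ⟨.lor [.neg y] .hole [], rfl, fun x => rfl⟩
  · exact ⟨.lor [.neg (.land (y :: z :: l))] .hole [], rfl, fun x => rfl⟩

/-- The formula (p → (R₁∧…∧R_m → q)) ∧ (S₁∧…∧S_k∧q → t) → (S₁∧…∧S_k∧R₁∧…∧R_m∧p → t). -/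
def cutFormula (p q t : CL2) (R S : List CL2) : CL2 :=
  imp (land [imp p (conjImp R q), conjImp (S ++ [q]) t]) (conjImp (S ++ R ++ [p]) t)

namespace cutFormula

theorem provable_elem (p q t : Nat) (R S : List Nat) :
    Provable (cutFormula (elem p) (elem q) (elem t) (R.map elem) (S.map elem)) := by
  have elz_map : ∀ b, elz b ∘ elem = elem := fun b => by funext n; simp [elz]
  refine .of_elz_eq_self ?_ fun v => ?_
  · simp [cutFormula, elz_imp, elz_land, elz_conjImp, elz, elz_map]
  · have eval_comp : eval v ∘ elem = v := by funext n; simp [eval]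
    simp only [cutFormula, eval_imp, eval_land, eval_conjImp, List.all_append, List.all_map,
      List.all_cons, List.all_nil, eval_comp, eval]
    cases R.all v <;> cases S.all v <;> cases v p <;> cases v q <;> cases v t <;> rfl

theorem provable_gen_left (P : Nat) {q t : CL2} {R S : List CL2}
    (h : ∀ a, Provable (cutFormula (elem a) q t R S)) :
    Provable (cutFormula (gen P) q t R S) := by
  obtain ⟨C, hC, hf⟩ := exists_sctx_conjImp_antecedent (S ++ R) [] t
  have key := Provable.of_forall_elem (.lorS []
    (.neg (.land [] (.lor [] (.neg .hole) [conjImp R q]) [conjImp (S ++ [q]) t])) [] C []) P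
    (by simp [DCtx.negCount1, DCtx.negCount2, SCtx.negCount, hC])
  simp only [DCtx.fill2, hf] at key
  exact key h

theorem provable_gen_middle (Q : Nat) {p t : CL2} {R S : List CL2}
    (h : ∀ a, Provable (cutFormula p (elem a) t R S)) :
    Provable (cutFormula p (gen Q) t R S) := by
  obtain ⟨C, hC, hf⟩ := exists_sctx_conjImp_consequent R
  obtain ⟨C', hC', hf'⟩ := exists_sctx_conjImp_antecedent S [] t
  have key := Provable.of_forall_elem (.lor []
    (.neg (.landS [] (.lor [.neg p] C []) [] C' [])) [conjImp (S ++ R ++ [p]) t]) Q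
    (by simp [DCtx.negCount1, DCtx.negCount2, SCtx.negCount, hC, hC'])
  simp only [DCtx.fill2, SCtx.fill, hf, hf'] at key
  exact key h

theorem provable_gen_right (T : Nat) {p q : CL2} {R S : List CL2}
    (h : ∀ a, Provable (cutFormula p q (elem a) R S)) :
    Provable (cutFormula p q (gen T) R S) := by
  obtain ⟨C, hC, hf⟩ := exists_sctx_conjImp_consequent (S ++ [q])
  obtain ⟨C', hC', hf'⟩ := exists_sctx_conjImp_consequent (S ++ R ++ [p])
  have key := Provable.of_forall_elem (.lorS []
    (.neg (.land [imp p (conjImp R q)] C [])) [] C' []) T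
    (by simp [DCtx.negCount1, DCtx.negCount2, SCtx.negCount, hC, hC'])
  simp only [DCtx.fill2, SCtx.fill, hf, hf'] at key
  exact key h

theorem provable_gen_first_list (A : Nat) {p q t : CL2} {l r S : List CL2}
    (h : ∀ a, Provable (cutFormula p q t (l ++ elem a :: r) S)) :
    Provable (cutFormula p q t (l ++ gen A :: r) S) := by
  obtain ⟨C, hC, hf⟩ := exists_sctx_conjImp_antecedent l r q
  obtain ⟨C', hC', hf'⟩ := exists_sctx_conjImp_antecedent (S ++ l) (r ++ [p]) t
  have key := Provable.of_forall_elem (.lorS []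
    (.neg (.land [] (.lor [.neg p] C []) [conjImp (S ++ [q]) t])) [] C' []) A
    (by simp [DCtx.negCount1, DCtx.negCount2, SCtx.negCount, hC, hC'])
  simp only [DCtx.fill2, SCtx.fill, hf, hf'] at key
  simp only [cutFormula, imp, List.append_assoc, List.cons_append, List.nil_append] at key h ⊢
  exact key h

theorem provable_gen_second_list (A : Nat) {p q t : CL2} {l r R : List CL2}
    (h : ∀ a, Provable (cutFormula p q t R (l ++ elem a :: r))) :
    Provable (cutFormula p q t R (l ++ gen A :: r)) := by
  obtain ⟨C, hC, hf⟩ := exists_sctx_conjImp_antecedent l (r ++ [q]) t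
  obtain ⟨C', hC', hf'⟩ := exists_sctx_conjImp_antecedent l (r ++ R ++ [p]) t
  have key := Provable.of_forall_elem (.lorS []
    (.neg (.land [imp p (conjImp R q)] C [])) [] C' []) A
    (by simp [DCtx.negCount1, DCtx.negCount2, SCtx.negCount, hC, hC'])
  simp only [DCtx.fill2, SCtx.fill, hf, hf'] at key
  simp only [cutFormula, imp, List.append_assoc, List.cons_append, List.nil_append] at key h ⊢
  exact key h

end cutFormula

theorem provable_map_gen_of_map_elem {f : List CL2 → CL2}
    (step : ∀ (A : Nat) (l r : List CL2), (∀ a, Provable (f (l ++ elem a :: r))) →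
      Provable (f (l ++ gen A :: r)))
    (L : List Nat) (h : ∀ as : List Nat, Provable (f (as.map elem))) :
    Provable (f (L.map gen)) := by
  suffices ∀ pre : List CL2, (∀ as : List Nat, Provable (f (pre ++ as.map elem))) →
      Provable (f (pre ++ L.map gen)) from this [] h
  induction L with
  | nil => exact fun pre h => h []
  | cons A L ih =>
    intro pre h
    refine step A pre _ fun a => ?_
    simpa using ih (pre ++ [elem a]) fun as => by simpa using h (a :: as)

/-- Lemma 8(f): for all m, k ≥ 0 and pairwise distinct general atoms
P, Q, T, R₁,…,R_m, S₁,…,S_k, the formula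
(P → (R₁∧…∧R_m → Q)) ∧ (S₁∧…∧S_k∧Q → T) → (S₁∧…∧S_k∧R₁∧…∧R_m∧P → T)
is provable in CL2. -/
theorem cl2_provable_f (m k : Nat) (P Q T : Nat) (R : Fin m → Nat) (S : Fin k → Nat)
    (hdist : (P :: Q :: T :: (List.ofFn R ++ List.ofFn S)).Nodup) :
    Provable (CL2.imp
      (CL2.land [CL2.imp (CL2.gen P) (conjImp ((List.ofFn R).map CL2.gen) (CL2.gen Q)),
                 conjImp ((List.ofFn S).map CL2.gen ++ [CL2.gen Q]) (CL2.gen T)])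
      (conjImp
        ((List.ofFn S).map CL2.gen ++ (List.ofFn R).map CL2.gen ++ [CL2.gen P])
        (CL2.gen T))) := by
  refine provable_map_gen_of_map_elem
    (f := fun L => cutFormula (gen P) (gen Q) (gen T) L ((List.ofFn S).map gen))
    (fun A l r => cutFormula.provable_gen_first_list A) _ fun R' => ?_
  refine provable_map_gen_of_map_elem
    (f := fun L => cutFormula (gen P) (gen Q) (gen T) (R'.map elem) L)
    (fun A l r => cutFormula.provable_gen_second_list A) _ fun S' => ?_
  exact cutFormula.provable_gen_left P fun p => cutFormula.provable_gen_middle Q fun q =>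
    cutFormula.provable_gen_right T fun t => cutFormula.provable_elem p q t R' S'
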